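/- Let q be a prime power and let n, k, δ be integers with 1 < k ≤ n−k and 1 ≤ δ ≤ k. Then there exists an (n,k,δ)_q lifted MRD code C^MRD (of size q^{(n−k)(k−δ+1)} with pairwise subspace distance ≥ 2δ) which can be partitioned into q^{(n−k)(k−δ)} parallel classes, each consisting of q^{n−k} codewords, such that in each parallel class every element of V^n is contained in exactly one codeword. -/

import Mathlib

open Module Polynomial Matrix

variable (F : Type) [Field F] [Fintype F]

/-- `C` is a `[k × (n-k), (n-k)(k-δ+1), δ]_q` MRD (maximum rank distance) code:
an `F`-linear subspace of `k × (n-k)` matrices of dimension `(n-k)(k-δ+1)` in which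
every nonzero matrix has rank at least `δ`. -/
def IsMRD (n k δ : ℕ) (C : Submodule F (Matrix (Fin k) (Fin (n - k)) F)) : Prop :=
  Module.finrank F C = (n - k) * (k - δ + 1) ∧
    ∀ A : Matrix (Fin k) (Fin (n - k)) F, A ∈ C → A ≠ 0 → δ ≤ A.rank

/-- The matrix `[I_k | A]`. -/
def liftMatrix (n k : ℕ) (A : Matrix (Fin k) (Fin (n - k)) F) : Matrix (Fin k) (Fin n) F :=
  Matrix.of fun i j =>
    if h : (j : ℕ) < k then (if (i : ℕ) = (j : ℕ) then 1 else 0)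
    else A i ⟨(j : ℕ) - k, by have := j.isLt; omega⟩

/-- The lifting of the matrix `A`: the row space of `[I_k | A]`, a subspace of `F^n`. -/
def liftSubspace (n k : ℕ) (A : Matrix (Fin k) (Fin (n - k)) F) : Submodule F (Fin n → F) :=
  Submodule.span F (Set.range fun i => liftMatrix F n k A i)

/-- The lifted code of a rank-metric code `C`: the set of liftings of all codewords of `C`. -/
def liftedCode (n k : ℕ) (C : Submodule F (Matrix (Fin k) (Fin (n - k)) F)) :
    Set (Submodule F (Fin n → F)) :=
  {X | ∃ A ∈ C, X = liftSubspace F n k A}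

/-- The subspace distance `d_S(X,Y) = dim X + dim Y - 2 dim (X ⊓ Y)`. -/
noncomputable def subDist {n : ℕ} (X Y : Submodule F (Fin n → F)) : ℕ :=
  finrank F X + finrank F Y - 2 * finrank F (X ⊓ Y : Submodule F (Fin n → F))

/-- `L^{(n,k)}`: vectors of `F^n` whose first `k` coordinates are not all zero. -/
def Lset (n k : ℕ) : Set (Fin n → F) := {v | ∃ i : Fin n, (i : ℕ) < k ∧ v i ≠ 0}

/-- `V^n`: one-dimensional subspaces of `F^n` spanned by vectors of `L^{(n,k)}`. -/
def Vset (n k : ℕ) : Set (Submodule F (Fin n → F)) :=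
  {X | ∃ v ∈ Lset F n k, X = Submodule.span F {v}}

/-- Projection of a vector of `F^n` onto its first `k` coordinates. -/
def projK (n k : ℕ) (v : Fin n → F) : Fin k → F :=
  fun i => if h : (i : ℕ) < n then v ⟨(i : ℕ), h⟩ else 0

/-- `V_A^{(n,k)}`: one-dimensional subspaces of `F^n` spanned by vectors whose projection
onto the first `k` coordinates is a nonzero vector spanning `A`. -/
def VA (n k : ℕ) (A : Submodule F (Fin k → F)) : Set (Submodule F (Fin n → F)) :=
  {X | ∃ v : Fin n → F, projK F n k v ≠ 0 ∧ Submodule.span F {projK F n k v} = A ∧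
    X = Submodule.span F {v}}

/-- `A_q(n,d,k)`: the maximum size of an `(n, M, d, k)_q` constant dimension code, i.e. of a
set of `k`-dimensional subspaces of `F^n` whose pairwise subspace distances are at least `d`. -/
noncomputable def Aq (n d k : ℕ) : ℕ :=
  sSup {M | ∃ S : Set (Submodule F (Fin n → F)), S.Finite ∧ S.ncard = M ∧
    (∀ X ∈ S, finrank F X = k) ∧ ∀ X ∈ S, ∀ Y ∈ S, X ≠ Y → d ≤ subDist F X Y}

/-- The Gaussian coefficient `[n, k]_q`: the number of `k`-dimensional subspaces of `F^n`. -/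
noncomputable def gaussNat (n k : ℕ) : ℕ :=
  Nat.card {X : Submodule F (Fin n → F) // finrank F X = k}

section Linearized

variable (K : Type) [Field K] [Algebra F K]

/-- The `q`-linearized polynomial `x ↦ ∑ j, a j * x ^ q ^ j`, as an `F`-linear map which depends
linearly on the coefficients `a`. -/
noncomputable def linearizedMap (s : ℕ) : (Fin s → K) →ₗ[F] K →ₗ[F] K :=
  (Fintype.linearCombination K fun j : Fin s =>
    (FiniteField.frobeniusAlgHom F K ^ (j : ℕ)).toLinearMap).restrictScalars F

theorem linearizedMap_apply (s : ℕ) (a : Fin s → K) (x : K) :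
    linearizedMap F K s a x = ∑ j, a j * x ^ Fintype.card F ^ (j : ℕ) := by
  simp [linearizedMap, Fintype.linearCombination_apply, AlgHom.coe_pow,
    FiniteField.coe_frobeniusAlgHom, pow_iterate]

theorem linearizedMap_cons (s : ℕ) (c : K) (r : Fin s → K) (x : K) :
    linearizedMap F K (s + 1) (Fin.cons c r) x =
      c * x + ∑ j, r j * x ^ Fintype.card F ^ ((j : ℕ) + 1) := by
  simp [linearizedMap_apply, Fin.sum_univ_succ]

/-- A nonzero linearized polynomial of `q`-degree at most `s` has kernel of dimension
at most `s`. -/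
theorem finrank_ker_linearizedMap_le [Finite K] (s : ℕ) (a : Fin (s + 1) → K) (ha : a ≠ 0) :
    finrank F (LinearMap.ker (linearizedMap F K (s + 1) a)) ≤ s := by
  classical
  have := Fintype.ofFinite K
  have hq : 1 < Fintype.card F := Fintype.one_lt_card
  set p : K[X] := ∑ j, C (a j) * X ^ Fintype.card F ^ (j : ℕ) with hp
  have hp0 : p ≠ 0 := by
    obtain ⟨i, hi⟩ := Function.ne_iff.mp ha
    refine fun h => hi ?_
    have hc := congrArg (fun r => r.coeff (Fintype.card F ^ (i : ℕ))) h
    simp only [hp, finsetSum_coeff, coeff_C_mul_X_pow, coeff_zero] at hc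
    rw [Finset.sum_eq_single i] at hc
    · simpa using hc
    · intro j _ hj
      rw [if_neg]
      exact fun h => hj (Fin.ext (Nat.pow_right_injective hq h).symm)
    · simp
  have hdeg : p.natDegree ≤ Fintype.card F ^ s :=
    natDegree_sum_le_of_forall_le _ _ fun j _ =>
      (natDegree_C_mul_X_pow_le _ _).trans
        (Nat.pow_le_pow_right hq.le (Nat.lt_succ_iff.mp j.isLt))
  have hcard : Fintype.card (LinearMap.ker (linearizedMap F K (s + 1) a)) ≤
      Fintype.card F ^ s := by
    refine (Set.toFinset_card
      (LinearMap.ker (linearizedMap F K (s + 1) a) : Set K)).symm.trans_le ?_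
    refine (card_le_degree_of_subset_roots fun x hx => ?_).trans hdeg
    rw [Finset.mem_val, Set.mem_toFinset, SetLike.mem_coe, LinearMap.mem_ker,
      linearizedMap_apply] at hx
    rw [mem_roots hp0, IsRoot.def, hp, eval_finsetSum]
    simpa using hx
  rw [Module.card_eq_pow_finrank (K := F)] at hcard
  exact (Nat.pow_le_pow_iff_right hq).mp hcard

variable {K}

/-- The matrix, acting on row vectors, of the linearized polynomial with coefficients `a`
restricted along `φ` and read in the coordinates `e`. The range is a Gabidulin code. -/
noncomputable def gabidulinMatrix {k m : ℕ} (s : ℕ) (φ : (Fin k → F) →ₗ[F] K)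
    (e : K ≃ₗ[F] (Fin m → F)) : (Fin s → K) →ₗ[F] Matrix (Fin k) (Fin m) F :=
  (LinearMap.toMatrix' ≪≫ₗ Matrix.transposeLinearEquiv (Fin m) (Fin k) F F).toLinearMap ∘ₗ
    LinearMap.llcomp F (Fin k → F) K (Fin m → F) e.toLinearMap ∘ₗ
    LinearMap.lcomp F K φ ∘ₗ linearizedMap F K s

theorem vecMul_gabidulinMatrix {k m : ℕ} (s : ℕ) (φ : (Fin k → F) →ₗ[F] K)
    (e : K ≃ₗ[F] (Fin m → F)) (a : Fin s → K) (u : Fin k → F) :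
    u ᵥ* gabidulinMatrix F s φ e a = e (linearizedMap F K s a (φ u)) := by
  simp [gabidulinMatrix, Matrix.vecMul_transpose, LinearMap.toMatrix'_mulVec]

end Linearized

set_option linter.unusedSectionVars false in
theorem Matrix.rank_add_finrank_ker_vecMulLinear {k m : ℕ} (A : Matrix (Fin k) (Fin m) F) :
    A.rank + finrank F (LinearMap.ker A.vecMulLinear) = k := by
  rw [A.rank_eq_finrank_span_row, ← range_vecMulLinear,
    LinearMap.finrank_range_add_finrank_ker, finrank_fin_fun]

theorem le_rank_gabidulinMatrix {K : Type} [Field K] [Finite K] [Algebra F K] {k m : ℕ} (s : ℕ)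
    (φ : (Fin k → F) →ₗ[F] K) (hφ : Function.Injective φ) (e : K ≃ₗ[F] (Fin m → F))
    (a : Fin (s + 1) → K) (ha : a ≠ 0) :
    k ≤ (gabidulinMatrix F (s + 1) φ e a).rank + s := by
  have hker : finrank F (LinearMap.ker (gabidulinMatrix F (s + 1) φ e a).vecMulLinear) ≤ s := by
    rw [(Submodule.equivMapOfInjective φ hφ _).finrank_eq]
    refine (Submodule.finrank_mono ?_).trans (finrank_ker_linearizedMap_le F K s a ha)
    rintro _ ⟨u, hu, rfl⟩
    simpa [vecMul_gabidulinMatrix] using hu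
  have := Matrix.rank_add_finrank_ker_vecMulLinear F (gabidulinMatrix F (s + 1) φ e a)
  omega

section Lifting

variable {n k : ℕ}

set_option linter.unusedSectionVars false

theorem liftSubspace_eq_range (A : Matrix (Fin k) (Fin (n - k)) F) :
    liftSubspace F n k A = LinearMap.range (liftMatrix F n k A).vecMulLinear :=
  (range_vecMulLinear _).symm

theorem vecMul_liftMatrix_left (hkn : k ≤ n) (A : Matrix (Fin k) (Fin (n - k)) F)
    (u : Fin k → F) (i : Fin k) : (u ᵥ* liftMatrix F n k A) (Fin.castLE hkn i) = u i := by
  simp [Matrix.vecMul, dotProduct, liftMatrix, Fin.val_inj]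

theorem vecMul_liftMatrix_right (A : Matrix (Fin k) (Fin (n - k)) F) (u : Fin k → F)
    (j : Fin (n - k)) :
    (u ᵥ* liftMatrix F n k A) ⟨k + j, by omega⟩ = (u ᵥ* A) j := by
  simp [Matrix.vecMul, dotProduct, liftMatrix]

theorem vecMul_liftMatrix_injective (hkn : k ≤ n) (A : Matrix (Fin k) (Fin (n - k)) F) :
    Function.Injective (liftMatrix F n k A).vecMulLinear := fun u u' h => by
  ext i
  simpa [vecMul_liftMatrix_left] using congrFun h (Fin.castLE hkn i)

theorem mem_liftSubspace_iff (hkn : k ≤ n) (A : Matrix (Fin k) (Fin (n - k)) F)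
    (v : Fin n → F) :
    v ∈ liftSubspace F n k A ↔
      (fun i => v (Fin.castLE hkn i)) ᵥ* A = fun j : Fin (n - k) => v ⟨k + j, by omega⟩ := by
  rw [liftSubspace_eq_range]
  constructor
  · rintro ⟨u, rfl⟩
    simp [vecMul_liftMatrix_left, vecMul_liftMatrix_right]
  · intro h
    refine ⟨fun i => v (Fin.castLE hkn i), funext fun j => ?_⟩
    by_cases hj : (j : ℕ) < k
    · exact vecMul_liftMatrix_left F hkn A _ ⟨j, hj⟩
    · obtain ⟨l, hl⟩ : ∃ l : Fin (n - k), j = ⟨k + l, by omega⟩ :=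
        ⟨⟨j - k, by omega⟩, Fin.ext (by simp; omega)⟩
      rw [hl]
      exact (vecMul_liftMatrix_right F A _ l).trans (congrFun h l)

theorem finrank_liftSubspace (hkn : k ≤ n) (A : Matrix (Fin k) (Fin (n - k)) F) :
    finrank F (liftSubspace F n k A) = k := by
  rw [liftSubspace_eq_range, LinearMap.finrank_range_of_inj (vecMul_liftMatrix_injective F hkn A),
    finrank_fin_fun]

theorem finrank_liftSubspace_inf_add_rank_le (hkn : k ≤ n)
    (A B : Matrix (Fin k) (Fin (n - k)) F) :
    finrank F (liftSubspace F n k A ⊓ liftSubspace F n k B : Submodule F (Fin n → F)) +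
      (A - B).rank ≤ k := by
  have hle : liftSubspace F n k A ⊓ liftSubspace F n k B ≤
      (LinearMap.ker (A - B).vecMulLinear).map (liftMatrix F n k A).vecMulLinear := by
    rintro v ⟨hA, hB⟩
    obtain ⟨u, rfl⟩ := liftSubspace_eq_range F A ▸ hA
    refine ⟨u, ?_, rfl⟩
    have h := (mem_liftSubspace_iff F hkn B _).mp hB
    simp only [Matrix.vecMulLinear_apply, vecMul_liftMatrix_left, vecMul_liftMatrix_right] at h
    simp [h]
  have h1 := (Submodule.finrank_mono hle).trans (Submodule.finrank_map_le _ _)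
  have h2 := Matrix.rank_add_finrank_ker_vecMulLinear F (A - B)
  omega

theorem two_mul_rank_sub_le_subDist (hkn : k ≤ n) (A B : Matrix (Fin k) (Fin (n - k)) F) :
    2 * (A - B).rank ≤ subDist F (liftSubspace F n k A) (liftSubspace F n k B) := by
  have := finrank_liftSubspace_inf_add_rank_le F hkn A B
  rw [subDist, finrank_liftSubspace F hkn, finrank_liftSubspace F hkn]
  omega

theorem liftSubspace_injective (hkn : k ≤ n) : Function.Injective (liftSubspace F n k) := by
  intro A B h
  refine funext fun i => ?_
  have hi : Pi.single i 1 ᵥ* liftMatrix F n k A ∈ liftSubspace F n k B :=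
    h ▸ liftSubspace_eq_range F A ▸ ⟨_, rfl⟩
  rw [mem_liftSubspace_iff F hkn] at hi
  simp only [vecMul_liftMatrix_left, vecMul_liftMatrix_right] at hi
  ext j
  simpa using (congrFun hi j).symm

end Lifting

theorem exists_finite_field_extension (m : ℕ) (hm : m ≠ 0) :
    ∃ (K : Type) (_ : Field K) (_ : Finite K) (_ : Algebra F K), finrank F K = m := by
  obtain ⟨p, _⟩ := CharP.exists F
  have : Fact p.Prime := ⟨CharP.char_is_prime F p⟩
  have : NeZero m := ⟨hm⟩
  exact ⟨FiniteField.Extension F p m, inferInstance, inferInstance, inferInstance,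
    FiniteField.finrank_extension F p m⟩

/-- There exists an `(n,k,δ)_q` lifted MRD code (of size `q^{(n-k)(k-δ+1)}`,
with pairwise subspace distance at least `2δ`) which can be partitioned into `q^{(n-k)(k-δ)}`
parallel classes, each of size `q^{n-k}`, such that in each parallel class every element of
`V^n` is contained in exactly one codeword. -/
theorem stmt7 (q n k δ : ℕ) (hq : Fintype.card F = q)
    (hk : 1 < k) (hkn : k ≤ n - k) (hδ1 : 1 ≤ δ) (hδk : δ ≤ k) :
    ∃ C : Submodule F (Matrix (Fin k) (Fin (n - k)) F), IsMRD F n k δ C ∧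
      (liftedCode F n k C).ncard = q ^ ((n - k) * (k - δ + 1)) ∧
      (∀ X ∈ liftedCode F n k C, ∀ Y ∈ liftedCode F n k C, X ≠ Y → 2 * δ ≤ subDist F X Y) ∧
      ∃ P : Fin (q ^ ((n - k) * (k - δ))) → Set (Submodule F (Fin n → F)),
        (∀ i j, i ≠ j → Disjoint (P i) (P j)) ∧
        (⋃ i, P i) = liftedCode F n k C ∧
        (∀ i, (P i).ncard = q ^ (n - k)) ∧
        (∀ i, ∀ V ∈ Vset F n k, ∃! X, X ∈ P i ∧ V ≤ X) := by
  obtain ⟨K, _, _, _, hK⟩ := exists_finite_field_extension F (n - k) (by omega)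
  have := Fintype.ofFinite K
  have hn : k ≤ n := by omega
  let e : K ≃ₗ[F] (Fin (n - k) → F) := LinearEquiv.ofFinrankEq _ _ (by simp [hK])
  let φ : (Fin k → F) →ₗ[F] K := Fintype.linearCombination F
    fun i => Module.finBasisOfFinrankEq F K hK (Fin.castLE hkn i)
  have hφ : Function.Injective φ :=
    linearIndependent_iff_injective_fintypeLinearCombination.mp
      ((Module.finBasisOfFinrankEq F K hK).linearIndependent.comp _ (Fin.castLE_injective hkn))
  obtain ⟨s, rfl⟩ := Nat.exists_eq_add_of_le hδk
  rw [Nat.add_sub_cancel_left]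
  set G := gabidulinMatrix F (s + 1) φ e with hG
  have hrank : ∀ a, a ≠ 0 → δ ≤ (G a).rank := fun a ha => by
    have := le_rank_gabidulinMatrix F s φ hφ e a ha
    rw [← hG] at this
    omega
  have hGinj : Function.Injective G := (injective_iff_map_eq_zero G).mpr fun a h => by
    by_contra ha
    have := hrank a ha
    rw [h, Matrix.rank_zero] at this
    omega
  have hLinj : Function.Injective fun a => liftSubspace F n (δ + s) (G a) :=
    (liftSubspace_injective F hn).comp hGinj
  have hcode : liftedCode F n (δ + s) (LinearMap.range G) =
      Set.range fun a => liftSubspace F n (δ + s) (G a) := by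
    ext X
    simp [liftedCode, eq_comm]
  have hcardK : Fintype.card K = q ^ (n - (δ + s)) := by
    rw [Module.card_eq_pow_finrank (K := F), hK, hq]
  refine ⟨LinearMap.range G, ⟨?_, ?_⟩, ?_, ?_, ?_⟩
  · rw [LinearMap.finrank_range_of_inj hGinj, Module.finrank_pi_fintype]
    simp [hK, mul_comm]
  · rintro _ ⟨a, rfl⟩ ha
    exact hrank a (by rintro rfl; simp at ha)
  · rw [hcode, ← Nat.card_coe_set_eq, Nat.card_range_of_injective hLinj]
    simp [hcardK, pow_mul]
  · rw [hcode]
    rintro _ ⟨a, rfl⟩ _ ⟨b, rfl⟩ hab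
    refine le_trans ?_ (two_mul_rank_sub_le_subDist F hn _ _)
    rw [← map_sub]
    exact Nat.mul_le_mul_left 2 (hrank _ (sub_ne_zero.mpr (by rintro rfl; exact hab rfl)))
  · let g : Fin (q ^ ((n - (δ + s)) * s)) ≃ (Fin s → K) :=
      Fintype.equivOfCardEq (by simp [hcardK, pow_mul])
    refine ⟨fun i => Set.range fun c : K =>
      liftSubspace F n (δ + s) (G (Fin.cons c (g i))), ?_, ?_, ?_, ?_⟩
    · intro i j hij
      rw [Set.disjoint_left]
      rintro _ ⟨c, rfl⟩ ⟨d, hd⟩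
      exact hij (g.injective (Fin.cons_inj.mp (hLinj hd)).2.symm)
    · rw [hcode]
      ext X
      simp only [Set.mem_iUnion, Set.mem_range]
      constructor
      · rintro ⟨i, c, rfl⟩
        exact ⟨_, rfl⟩
      · rintro ⟨a, rfl⟩
        exact ⟨g.symm (Fin.tail a), a 0, by simp [Fin.cons_self_tail]⟩
    · intro i
      rw [← Nat.card_coe_set_eq, Nat.card_range_of_injective, Nat.card_eq_fintype_card, hcardK]
      exact fun c d h => (Fin.cons_inj.mp (hLinj h)).1
    · rintro i _ ⟨v, ⟨l, hl, hvl⟩, rfl⟩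
      set u : Fin (δ + s) → F := fun i => v (Fin.castLE hn i) with hu
      have hβ : φ u ≠ 0 := (map_ne_zero_iff φ hφ).mpr
        (Function.ne_iff.mpr ⟨⟨l, hl⟩, hvl⟩)
      set τ : K := ∑ j, g i j * φ u ^ Fintype.card F ^ ((j : ℕ) + 1) with hτ
      set ω : K := e.symm fun j : Fin (n - (δ + s)) => v ⟨δ + s + j, by omega⟩ with hω
      have key : ∀ c : K, Submodule.span F {v} ≤
          liftSubspace F n (δ + s) (G (Fin.cons c (g i))) ↔ c = (ω - τ) / φ u := fun c => by
        rw [Submodule.span_singleton_le_iff_mem, mem_liftSubspace_iff F hn, ← hu, hG,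
          vecMul_gabidulinMatrix, linearizedMap_cons, ← hτ, ← LinearEquiv.eq_symm_apply, ← hω,
          eq_div_iff hβ, eq_sub_iff_add_eq]
      refine ⟨_, ⟨⟨(ω - τ) / φ u, rfl⟩, (key _).mpr rfl⟩, ?_⟩
      rintro _ ⟨⟨c, rfl⟩, hc⟩
      rw [(key c).mp hc]
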